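/- Let M = (W,R,V) be a Kripke model with W finite of cardinality n, let w ∈ W, and let φ be a sentence of the modal μ-calculus in normal form. Then M,w ⊨ φ in the standard compositional semantics if and only if Eloise has a winning strategy in the (n+1)-bounded evaluation game (M, w, φ, n+1); in particular, on finite models finite clock values at most the cardinality of the model suffice. -/

import Mathlib

/-- Formulae of the modal μ-calculus, with negation only on proposition symbols:
`φ ::= p | ¬p | X | φ∨φ | φ∧φ | ◇φ | □φ | μX φ | νX φ`. -/
inductive Formula (Φ Λ : Type) : Type
  | atom  : Φ → Formula Φ Λ
  | natom : Φ → Formula Φ Λ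
  | label : Λ → Formula Φ Λ
  | or    : Formula Φ Λ → Formula Φ Λ → Formula Φ Λ
  | and   : Formula Φ Λ → Formula Φ Λ → Formula Φ Λ
  | dia   : Formula Φ Λ → Formula Φ Λ
  | box   : Formula Φ Λ → Formula Φ Λ
  | mu    : Λ → Formula Φ Λ → Formula Φ Λ
  | nu    : Λ → Formula Φ Λ → Formula Φ Λ

/-- A Kripke model `M = (W,R,V)` over the (nonempty) set `W` of worlds. -/
structure Kripke (Φ W : Type) where
  R : W → W → Prop
  V : Φ → Set W

variable {Φ Λ W : Type}
/-- Standard compositional semantics of the modal μ-calculus: `sat M φ s` is the set of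
worlds where `φ` holds under assignment `s`.  The `μX ψ` (resp. `νX ψ`) clause is the least
(resp. greatest) fixed point of the operator `A ↦ sat M ψ (s[A/X])`, given à la
Knaster–Tarski. -/
def sat [DecidableEq Λ] (M : Kripke Φ W) : Formula Φ Λ → (Λ → Set W) → Set W
  | .atom p, _ => M.V p
  | .natom p, _ => (M.V p)ᶜ
  | .label X, s => s X
  | .or φ ψ, s => sat M φ s ∪ sat M ψ s
  | .and φ ψ, s => sat M φ s ∩ sat M ψ s
  | .dia φ, s => {w | ∃ v, M.R w v ∧ v ∈ sat M φ s}
  | .box φ, s => {w | ∀ v, M.R w v → v ∈ sat M φ s}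
  | .mu X φ, s => sInf {A | sat M φ (Function.update s X A) ⊆ A}
  | .nu X φ, s => sSup {A | A ⊆ sat M φ (Function.update s X A)}
/-- The set of label symbols occurring free in a formula. -/
def freeLabels : Formula Φ Λ → Set Λ
  | .atom _ => ∅
  | .natom _ => ∅
  | .label X => {X}
  | .or φ ψ => freeLabels φ ∪ freeLabels ψ
  | .and φ ψ => freeLabels φ ∪ freeLabels ψ
  | .dia φ => freeLabels φ
  | .box φ => freeLabels φ
  | .mu X φ => freeLabels φ \ {X}
  | .nu X φ => freeLabels φ \ {X}

/-- A sentence is a formula with no free label symbols. -/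
def IsSentence (φ : Formula Φ Λ) : Prop := freeLabels φ = ∅

/-- The list of label symbols bound by the μ- and ν-operator occurrences of a formula
(with multiplicity). -/
def binderList : Formula Φ Λ → List Λ
  | .atom _ => []
  | .natom _ => []
  | .label _ => []
  | .or φ ψ => binderList φ ++ binderList ψ
  | .and φ ψ => binderList φ ++ binderList ψ
  | .dia φ => binderList φ
  | .box φ => binderList φ
  | .mu X φ => X :: binderList φ
  | .nu X φ => X :: binderList φ

/-- A formula is in normal form if each label symbol occurs at most once bound by a
μ- or ν-operator in it. -/
def NormalForm (φ : Formula Φ Λ) : Prop := (binderList φ).Nodup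
open scoped Classical

/-- The two players of the evaluation game. -/
inductive Player : Type
  | eloise
  | abelard
deriving DecidableEq

/-- A position `(w, φ, c)` of a Γ-bounded evaluation game for a sentence `φ₀`: a world `w`,
an occurrence of a subformula of `φ₀` (represented by its address `addr` in the syntax tree
of `φ₀`), and a clock mapping `c` assigning ordinals to (addresses of) subformula
occurrences of `φ₀`. -/
structure GPos (W : Type) where
  world : W
  addr : List ℕ
  clock : List ℕ → Ordinal

/-- The subformula occurrence of `φ` at address `o` in its syntax tree
(`0` = left/unique child, `1` = right child), if any. -/
def nodeAt : Formula Φ Λ → List ℕ → Option (Formula Φ Λ)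
  | φ, [] => some φ
  | .or φ _, 0 :: t => nodeAt φ t
  | .or _ ψ, 1 :: t => nodeAt ψ t
  | .and φ _, 0 :: t => nodeAt φ t
  | .and _ ψ, 1 :: t => nodeAt ψ t
  | .dia φ, 0 :: t => nodeAt φ t
  | .box φ, 0 :: t => nodeAt φ t
  | .mu _ φ, 0 :: t => nodeAt φ t
  | .nu _ φ, 0 :: t => nodeAt φ t
  | _, _ => none

/-- Whether the occurrence at address `o` in `φ₀` is a μν-subformula occurrence. -/
def muNuAt (φ₀ : Formula Φ Λ) (o : List ℕ) : Bool :=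
  match nodeAt φ₀ o with
  | some (.mu _ _) => true
  | some (.nu _ _) => true
  | _ => false

/-- Whether the occurrence at address `o` in `φ₀` is of the form `μX ψ` or `νX ψ`. -/
def bindsAt [DecidableEq Λ] (φ₀ : Formula Φ Λ) (X : Λ) (o : List ℕ) : Bool :=
  match nodeAt φ₀ o with
  | some (.mu Y _) => decide (Y = X)
  | some (.nu Y _) => decide (Y = X)
  | _ => false

/-- The (address of the) reference formula `rf(X)` of an occurrence of the label `X`
at address `o` in `φ₀`: the innermost (longest) binder `μX ψ` / `νX ψ` on the branch
from the root to `o`. -/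
def refOcc [DecidableEq Λ] (φ₀ : Formula Φ Λ) (X : Λ) (o : List ℕ) : Option (List ℕ) :=
  (o.inits.filter (fun o' => bindsAt φ₀ X o')).getLast?

/-- The player (if any) to move at a position: Eloise resolves `∨`, `◇`, `μ` and labels
bound by `μ`; Abelard resolves `∧`, `□`, `ν` and labels bound by `ν`; nobody moves at
literals. -/
def turn [DecidableEq Λ] (φ₀ : Formula Φ Λ) (p : GPos W) : Option Player :=
  match nodeAt φ₀ p.addr with
  | some (.or _ _) => some .eloise
  | some (.and _ _) => some .abelard
  | some (.dia _) => some .eloise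
  | some (.box _) => some .abelard
  | some (.mu _ _) => some .eloise
  | some (.nu _ _) => some .abelard
  | some (.label X) =>
      match (refOcc φ₀ X p.addr).bind (nodeAt φ₀) with
      | some (.mu _ _) => some .eloise
      | some (.nu _ _) => some .abelard
      | _ => none
  | _ => none

/-- The clock mapping after a move at a label occurrence whose reference formula sits at
address `r`: the clock of `r` becomes `γ'`, clocks of all μν-subformula occurrences of the
body of the reference formula are reset to `Γ`, all other clocks are unchanged. -/
def clockReset (Γ γ' : Ordinal) (r : List ℕ) (c : List ℕ → Ordinal) : List ℕ → Ordinal :=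
  fun o => if o = r then γ' else if (r ++ [0]).isPrefixOf o then Γ else c o

/-- The set of positions reachable from `p` in one round of the Γ-bounded evaluation game
for `φ₀` on `M`, according to the rules of the game. -/
def moves [DecidableEq Λ] (M : Kripke Φ W) (φ₀ : Formula Φ Λ) (Γ : Ordinal)
    (p : GPos W) : Set (GPos W) :=
  match nodeAt φ₀ p.addr with
  | some (.or _ _) => {⟨p.world, p.addr ++ [0], p.clock⟩, ⟨p.world, p.addr ++ [1], p.clock⟩}
  | some (.and _ _) => {⟨p.world, p.addr ++ [0], p.clock⟩, ⟨p.world, p.addr ++ [1], p.clock⟩}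
  | some (.dia _) => {q | ∃ v, M.R p.world v ∧ q = ⟨v, p.addr ++ [0], p.clock⟩}
  | some (.box _) => {q | ∃ v, M.R p.world v ∧ q = ⟨v, p.addr ++ [0], p.clock⟩}
  | some (.mu _ _) =>
      {q | ∃ γ < Γ, q = ⟨p.world, p.addr ++ [0], Function.update p.clock p.addr γ⟩}
  | some (.nu _ _) =>
      {q | ∃ γ < Γ, q = ⟨p.world, p.addr ++ [0], Function.update p.clock p.addr γ⟩}
  | some (.label X) =>
      match refOcc φ₀ X p.addr with
      | some r => {q | ∃ γ' < p.clock r, q = ⟨p.world, r ++ [0], clockReset Γ γ' r p.clock⟩}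
      | none => ∅
  | _ => ∅

/-- The winner of the game at an ending position: at `(w,p,c)` Eloise wins iff `w ∈ V(p)`,
at `(w,¬p,c)` iff `w ∉ V(p)`; at any other position with no available moves, the player
who should move loses (so Abelard wins at `◇` with no successor and at labels bound by `μ`
with clock value `0`, and dually for Eloise). -/
noncomputable def winsTerminal [DecidableEq Λ] (M : Kripke Φ W) (φ₀ : Formula Φ Λ)
    (p : GPos W) : Player :=
  match nodeAt φ₀ p.addr with
  | some (.atom q) => if p.world ∈ M.V q then .eloise else .abelard
  | some (.natom q) => if p.world ∈ M.V q then .abelard else .eloise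
  | _ =>
      match turn φ₀ p with
      | some .eloise => .abelard
      | _ => .eloise

/-- The initial position `(w₀, φ₀, c₀)` of the game, where `c₀` is constantly `Γ`. -/
def initPos (w₀ : W) (Γ : Ordinal) : GPos W := ⟨w₀, [], fun _ => Γ⟩

/-- `ConsPlay M φ₀ Γ w₀ P σ f` : the finite sequence of positions `f` is a (partial) play of
the Γ-bounded evaluation game `(M, w₀, φ₀, Γ)` in which player `P` follows the positional
strategy `σ`: it starts at the initial position, every step obeys the rules of the game,
and at every position where `P` moves, the move is the one prescribed by `σ`. -/
def ConsPlay [DecidableEq Λ] (M : Kripke Φ W) (φ₀ : Formula Φ Λ) (Γ : Ordinal) (w₀ : W)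
    (P : Player) (σ : GPos W → GPos W) (f : List (GPos W)) : Prop :=
  f.head? = some (initPos w₀ Γ) ∧
    ∀ i, (h : i + 1 < f.length) →
      f[i + 1] ∈ moves M φ₀ Γ (f[i]'(Nat.lt_of_succ_lt h)) ∧
        (turn φ₀ (f[i]'(Nat.lt_of_succ_lt h)) = some P →
          f[i + 1] = σ (f[i]'(Nat.lt_of_succ_lt h)))

/-- `WinStrat M φ₀ Γ w₀ P σ` : the (positional) strategy `σ` is a winning strategy for
player `P` in the Γ-bounded evaluation game `(M, w₀, φ₀, Γ)`: along any play in which `P`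
follows `σ`, whenever it is `P`'s turn and some move is available, `σ` prescribes a legal
move (so `P` can always continue playing according to `σ`), and every ending position ever
reached is winning for `P`. -/
noncomputable def WinStrat [DecidableEq Λ] (M : Kripke Φ W) (φ₀ : Formula Φ Λ)
    (Γ : Ordinal) (w₀ : W) (P : Player) (σ : GPos W → GPos W) : Prop :=
  ∀ f, ConsPlay M φ₀ Γ w₀ P σ f → ∀ p, f.getLast? = some p →
    (turn φ₀ p = some P → (moves M φ₀ Γ p).Nonempty → σ p ∈ moves M φ₀ Γ p) ∧
      (moves M φ₀ Γ p = ∅ → winsTerminal M φ₀ p = P)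

universe u

section Approximants

/-- The `γ`-th approximant from below of the least fixed point of `F`. -/
def approxMu (F : Set W → Set W) (γ : Ordinal) : Set W :=
  {w | ∃ δ, ∃ _ : δ < γ, w ∈ F (approxMu F δ)}
termination_by γ

/-- The `γ`-th approximant from above of the greatest fixed point of `F`. -/
def approxNu (F : Set W → Set W) (γ : Ordinal) : Set W :=
  (approxMu (fun A => (F Aᶜ)ᶜ) γ)ᶜ

theorem mem_approxMu {F : Set W → Set W} {γ : Ordinal} {w : W} :
    w ∈ approxMu F γ ↔ ∃ δ < γ, w ∈ F (approxMu F δ) := by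
  rw [approxMu]; simp

theorem mem_approxNu {F : Set W → Set W} {γ : Ordinal} {w : W} :
    w ∈ approxNu F γ ↔ ∀ δ < γ, w ∈ F (approxNu F δ) := by
  simp [approxNu, mem_approxMu]

theorem approxMu_mono (F : Set W → Set W) : Monotone (approxMu F) := by
  intro γ δ h w hw
  obtain ⟨ε, hε, hw⟩ := mem_approxMu.1 hw
  exact mem_approxMu.2 ⟨ε, hε.trans_le h, hw⟩

theorem approxMu_subset_of_prefixed {F : Set W → Set W} (hF : Monotone F) {A : Set W}
    (hA : F A ⊆ A) (γ : Ordinal) : approxMu F γ ⊆ A := by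
  induction γ using WellFoundedLT.induction with
  | ind γ ih =>
    intro w hw
    obtain ⟨δ, hδ, hw⟩ := mem_approxMu.1 hw
    exact hA (hF (ih δ hδ) hw)

/-- On a finite set of cardinality `n`, the `n`-th approximant is already a prefixed point. -/
theorem prefixed_approxMu_card [Fintype W] {F : Set W → Set W} (hF : Monotone F) :
    F (approxMu F (Fintype.card W : Ordinal.{u})) ⊆ approxMu F (Fintype.card W : Ordinal.{u}) := by
  have step (k : ℕ) : F (approxMu F (k : Ordinal.{u})) ⊆ approxMu F ((k + 1 : ℕ) : Ordinal.{u}) :=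
    fun w hw => mem_approxMu.2 ⟨k, by exact_mod_cast k.lt_succ_self, hw⟩
  have grow (k : ℕ) : F (approxMu F (k : Ordinal.{u})) ⊆ approxMu F (k : Ordinal.{u}) ∨
      k + 1 ≤ (approxMu F ((k + 1 : ℕ) : Ordinal.{u})).ncard := by
    induction k with
    | zero =>
      by_cases h : F (approxMu F ((0 : ℕ) : Ordinal.{u})) ⊆ approxMu F ((0 : ℕ) : Ordinal.{u})
      · exact .inl h
      · obtain ⟨w, hw, -⟩ := Set.not_subset.1 h
        exact .inr ((Set.ncard_pos (Set.toFinite _)).2 ⟨w, step 0 hw⟩)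
    | succ k ih =>
      by_cases h : F (approxMu F ((k + 1 : ℕ) : Ordinal.{u})) ⊆ approxMu F ((k + 1 : ℕ) : Ordinal.{u})
      · exact .inl h
      · right
        have hle : approxMu F (k : Ordinal.{u}) ⊆ approxMu F ((k + 1 : ℕ) : Ordinal.{u}) :=
          approxMu_mono F (by exact_mod_cast k.le_succ)
        have hle' : approxMu F ((k + 1 : ℕ) : Ordinal.{u}) ⊆ approxMu F ((k + 1 + 1 : ℕ) : Ordinal.{u}) :=
          approxMu_mono F (by exact_mod_cast (k + 1).le_succ)
        have hlt : approxMu F ((k + 1 : ℕ) : Ordinal.{u}) ⊂ approxMu F ((k + 1 + 1 : ℕ) : Ordinal.{u}) :=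
          ⟨hle', fun h' => h ((step (k + 1)).trans h')⟩
        have hcard := Set.ncard_lt_ncard hlt (Set.toFinite _)
        rcases ih with ih | ih
        · refine absurd ((hF ?_).trans ((ih.trans hle))) h
          intro w hw
          obtain ⟨δ, hδ, hw⟩ := mem_approxMu.1 hw
          refine ih (hF (approxMu_mono F ?_) hw)
          rw [Nat.cast_add_one] at hδ
          exact Order.lt_add_one_iff.1 hδ
        · omega
  rcases grow (Fintype.card W) with h | h
  · exact h
  · have := Set.ncard_le_card (approxMu F ((Fintype.card W + 1 : ℕ) : Ordinal.{u}))
    rw [Nat.card_eq_fintype_card] at this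
    omega

theorem sInf_prefixed_eq_approxMu_card [Fintype W] {F : Set W → Set W} (hF : Monotone F) :
    sInf {A | F A ⊆ A} = approxMu F (Fintype.card W : Ordinal.{u}) :=
  le_antisymm (sInf_le (prefixed_approxMu_card hF))
    (le_sInf fun _ hA => approxMu_subset_of_prefixed hF hA _)

theorem compl_conj_monotone {F : Set W → Set W} (hF : Monotone F) :
    Monotone fun A => (F Aᶜ)ᶜ :=
  fun _ _ h => Set.compl_subset_compl.2 (hF (Set.compl_subset_compl.2 h))

theorem subset_approxNu_of_postfixed {F : Set W → Set W} (hF : Monotone F) {A : Set W}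
    (hA : A ⊆ F A) (γ : Ordinal) : A ⊆ approxNu F γ :=
  Set.subset_compl_comm.1 (approxMu_subset_of_prefixed (compl_conj_monotone hF)
    (by simpa using hA) γ)

theorem postfixed_approxNu_card [Fintype W] {F : Set W → Set W} (hF : Monotone F) :
    approxNu F (Fintype.card W : Ordinal.{u}) ⊆ F (approxNu F (Fintype.card W : Ordinal.{u})) :=
  Set.compl_subset_comm.1 (prefixed_approxMu_card (compl_conj_monotone hF))

theorem mem_sInf_prefixed_iff [Fintype W] {F : Set W → Set W} (hF : Monotone F) {w : W} :
    w ∈ sInf {A | F A ⊆ A} ↔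
      ∃ γ < (Fintype.card W : Ordinal) + 1, w ∈ F (approxMu F γ) := by
  constructor
  · intro h
    rw [sInf_prefixed_eq_approxMu_card hF] at h
    obtain ⟨γ, hγ, hw⟩ := mem_approxMu.1 h
    exact ⟨γ, hγ.trans (Order.lt_add_one_iff.2 le_rfl), hw⟩
  · rintro ⟨γ, -, hw⟩ A hA
    exact hA (hF (approxMu_subset_of_prefixed hF hA γ) hw)

theorem mem_sSup_postfixed_iff [Fintype W] {F : Set W → Set W} (hF : Monotone F) {w : W} :
    w ∈ sSup {A | A ⊆ F A} ↔
      ∀ γ < (Fintype.card W : Ordinal) + 1, w ∈ F (approxNu F γ) := by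
  constructor
  · rintro ⟨A, hA, hw⟩ γ -
    exact hF (subset_approxNu_of_postfixed hF hA γ) (hA hw)
  · intro h
    refine ⟨_, postfixed_approxNu_card hF, mem_approxNu.2 fun γ hγ => h γ ?_⟩
    exact hγ.trans (Order.lt_add_one_iff.2 le_rfl)

end Approximants

theorem sat_mono [DecidableEq Λ] (M : Kripke Φ W) (φ : Formula Φ Λ) : Monotone (sat M φ) := by
  induction φ with
  | atom p => exact fun _ _ _ => le_rfl
  | natom p => exact fun _ _ _ => le_rfl
  | label X => exact fun _ _ h => h X
  | or φ ψ ihφ ihψ => exact fun _ _ h => Set.union_subset_union (ihφ h) (ihψ h)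
  | and φ ψ ihφ ihψ => exact fun _ _ h => Set.inter_subset_inter (ihφ h) (ihψ h)
  | dia φ ih => exact fun _ _ h _ ⟨v, hv, hs⟩ => ⟨v, hv, ih h hs⟩
  | box φ ih => exact fun _ _ h _ hs v hv => ih h (hs v hv)
  | mu X φ ih =>
    exact fun _ _ h => sInf_le_sInf fun A hA =>
      (ih (update_le_update_iff.2 ⟨le_rfl, fun Y _ => h Y⟩)).trans hA
  | nu X φ ih =>
    exact fun _ _ h => sSup_le_sSup fun A hA =>
      hA.trans (ih (update_le_update_iff.2 ⟨le_rfl, fun Y _ => h Y⟩))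

theorem sat_update_mono [DecidableEq Λ] (M : Kripke Φ W) (φ : Formula Φ Λ) (s : Λ → Set W)
    (X : Λ) : Monotone fun A => sat M φ (Function.update s X A) :=
  fun _ _ h => sat_mono M φ (update_le_update_iff.2 ⟨h, fun _ _ => le_rfl⟩)

section Addresses

theorem nodeAt_nil (φ : Formula Φ Λ) : nodeAt φ [] = some φ := by
  cases φ <;> rfl

theorem nodeAt_append (φ : Formula Φ Λ) (o t : List ℕ) :
    nodeAt φ (o ++ t) = (nodeAt φ o).bind (nodeAt · t) := by
  induction o generalizing φ with
  | nil => simp [nodeAt_nil]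
  | cons i o ih =>
    cases φ <;> rcases i with _ | _ | i <;> first | rfl | exact ih _

theorem exists_length_lt_of_nodeAt (φ : Formula Φ Λ) :
    ∃ D, ∀ o χ, nodeAt φ o = some χ → o.length < D := by
  induction φ with
  | atom | natom | label =>
    refine ⟨1, fun o χ h => ?_⟩
    rcases o with _ | ⟨i, o⟩ <;> simp_all [nodeAt]
  | or φ ψ ihφ ihψ | and φ ψ ihφ ihψ =>
    obtain ⟨D, hD⟩ := ihφ
    obtain ⟨E, hE⟩ := ihψ
    refine ⟨D + E + 1, fun o χ h => ?_⟩
    rcases o with _ | ⟨_ | _ | i, o⟩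
    · simp
    · have := hD o χ h
      simp only [List.length_cons]; omega
    · have := hE o χ h
      simp only [List.length_cons]; omega
    · simp [nodeAt] at h
  | dia φ ih | box φ ih | mu _ φ ih | nu _ φ ih =>
    obtain ⟨D, hD⟩ := ih
    refine ⟨D + 1, fun o χ h => ?_⟩
    rcases o with _ | ⟨_ | i, o⟩
    · simp
    · simpa using hD o χ h
    · simp [nodeAt] at h

variable [DecidableEq Λ]

theorem bindsAt_eq_true_iff {φ : Formula Φ Λ} {X : Λ} {o : List ℕ} :
    bindsAt φ X o = true ↔
      ∃ ψ, nodeAt φ o = some (.mu X ψ) ∨ nodeAt φ o = some (.nu X ψ) := by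
  unfold bindsAt
  split <;> simp_all

theorem refOcc_nil (φ : Formula Φ Λ) (X : Λ) :
    refOcc φ X [] = if bindsAt φ X [] then some [] else none := by
  by_cases h : bindsAt φ X [] <;> simp [refOcc, h]

theorem refOcc_concat (φ : Formula Φ Λ) (X : Λ) (o : List ℕ) (i : ℕ) :
    refOcc φ X (o ++ [i]) =
      if bindsAt φ X (o ++ [i]) then some (o ++ [i]) else refOcc φ X o := by
  by_cases h : bindsAt φ X (o ++ [i]) <;> simp [refOcc, List.inits_append, h]

theorem refOcc_eq_some {φ : Formula Φ Λ} {X : Λ} {o r : List ℕ} (h : refOcc φ X o = some r) :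
    r <+: o ∧ bindsAt φ X r := by
  have := List.mem_of_getLast? h
  simpa using this

/-- A label occurrence without a reference formula is free in the whole formula. -/
theorem mem_freeLabels_of_refOcc_eq_none {φ χ : Formula Φ Λ} {X : Λ} {o : List ℕ}
    (hχ : nodeAt φ o = some χ) (hX : X ∈ freeLabels χ) (h : refOcc φ X o = none) :
    X ∈ freeLabels φ := by
  induction o using List.reverseRecOn generalizing χ with
  | nil =>
    rw [nodeAt_nil] at hχ
    cases hχ
    exact hX
  | append_singleton o i ih =>
    rw [refOcc_concat] at h
    split at h
    · simp at h
    · rw [nodeAt_append, Option.bind_eq_some_iff] at hχ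
      obtain ⟨ψ, hψ, hχ⟩ := hχ
      have hb : bindsAt φ X o ≠ true := by
        intro hb
        rcases o.eq_nil_or_concat with rfl | ⟨o, j, rfl⟩
        · simp [refOcc_nil, hb] at h
        · simp only [List.concat_eq_append] at h hb
          simp [refOcc_concat, hb] at h
      rw [Ne, bindsAt_eq_true_iff] at hb
      refine ih hψ ?_ h
      cases ψ <;> rcases i with _ | _ | i <;>
        simp only [nodeAt, nodeAt_nil, zero_add, Option.some.injEq, reduceCtorEq] at hχ <;>
        subst hχ <;> simp_all [freeLabels] <;> grind

end Addresses

section Truth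

variable [DecidableEq Λ]

/-- The assignment for the body of a binder with clock value `γ`: its label is interpreted by
the `γ`-th approximant. On formulae that are not binders the assignment is unchanged. -/
def bindAssignment (M : Kripke Φ W) (s : Λ → Set W) (γ : Ordinal) :
    Formula Φ Λ → (Λ → Set W)
  | .mu X ψ => Function.update s X (approxMu (fun A => sat M ψ (Function.update s X A)) γ)
  | .nu X ψ => Function.update s X (approxNu (fun A => sat M ψ (Function.update s X A)) γ)
  | _ => s

/-- The assignment at the reversal of an address determined by the clock values of the binders
strictly above it. -/
def clockAssignmentRev (M : Kripke Φ W) (φ : Formula Φ Λ) (s : Λ → Set W)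
    (c : List ℕ → Ordinal) : List ℕ → (Λ → Set W)
  | [] => s
  | _ :: o =>
    (nodeAt φ o.reverse).elim (clockAssignmentRev M φ s c o)
      (bindAssignment M (clockAssignmentRev M φ s c o) (c o.reverse))

/-- The assignment at an address determined by the clock values of the binders strictly
above it. -/
def clockAssignment (M : Kripke Φ W) (φ : Formula Φ Λ) (s : Λ → Set W)
    (c : List ℕ → Ordinal) (o : List ℕ) : Λ → Set W :=
  clockAssignmentRev M φ s c o.reverse

variable {M : Kripke Φ W} {φ : Formula Φ Λ} {s : Λ → Set W}

theorem clockAssignment_concat (c : List ℕ → Ordinal) (o : List ℕ) (i : ℕ) :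
    clockAssignment M φ s c (o ++ [i]) =
      (nodeAt φ o).elim (clockAssignment M φ s c o)
        (bindAssignment M (clockAssignment M φ s c o) (c o)) := by
  simp [clockAssignment, clockAssignmentRev]

theorem clockAssignment_congr {c c' : List ℕ → Ordinal} {o : List ℕ}
    (h : ∀ o', o' <+: o → o'.length < o.length → c o' = c' o') :
    clockAssignment M φ s c o = clockAssignment M φ s c' o := by
  induction o using List.reverseRecOn with
  | nil => rfl
  | append_singleton o i ih =>
    rw [clockAssignment_concat, clockAssignment_concat, h o (List.prefix_append _ _) (by simp),
      ih fun o' ho' hl => h o' (ho'.trans (List.prefix_append _ _)) (by simp; omega)]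

theorem clockAssignment_concat_of_not_bindsAt {X : Λ} {o : List ℕ} (c : List ℕ → Ordinal)
    (i : ℕ) (h : ¬ bindsAt φ X o = true) :
    clockAssignment M φ s c (o ++ [i]) X = clockAssignment M φ s c o X := by
  rw [bindsAt_eq_true_iff] at h
  rw [clockAssignment_concat]
  rcases hχ : nodeAt φ o with _ | χ
  · rfl
  · cases χ <;> simp_all [bindAssignment, Function.update_apply] <;> grind

/-- The value of a label is determined at its reference formula. -/
theorem clockAssignment_of_refOcc {X : Λ} {o r : List ℕ} (c : List ℕ → Ordinal) (i : ℕ)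
    (h : refOcc φ X o = some r) :
    clockAssignment M φ s c (o ++ [i]) X = clockAssignment M φ s c (r ++ [0]) X := by
  induction o using List.reverseRecOn generalizing i with
  | nil =>
    rw [refOcc_nil] at h
    split at h <;> simp at h
    subst h
    exact congrFun ((clockAssignment_concat c [] i).trans (clockAssignment_concat c [] 0).symm) X
  | append_singleton o j ih =>
    rw [refOcc_concat] at h
    split at h
    · cases h
      simp only [clockAssignment_concat]
    · rw [clockAssignment_concat_of_not_bindsAt c i ‹_›, ih j h]

theorem clockAssignment_clockReset (Γ γ : Ordinal) (c : List ℕ → Ordinal) (r : List ℕ) :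
    clockAssignment M φ s (clockReset Γ γ r c) (r ++ [0]) =
      (nodeAt φ r).elim (clockAssignment M φ s c r)
        (bindAssignment M (clockAssignment M φ s c r) γ) := by
  have : clockAssignment M φ s (clockReset Γ γ r c) r = clockAssignment M φ s c r := by
    refine clockAssignment_congr fun o' _ hl => ?_
    have h1 : o' ≠ r := by rintro rfl; simp at hl
    have h2 : ¬ (r ++ [0] <+: o') := fun h => by
      have := h.length_le
      simp at this
      omega
    simp [clockReset, h1, h2]
  rw [clockAssignment_concat, this]
  simp [clockReset]

theorem clockAssignment_update (γ : Ordinal) (c : List ℕ → Ordinal) (o : List ℕ) :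
    clockAssignment M φ s (Function.update c o γ) (o ++ [0]) =
      (nodeAt φ o).elim (clockAssignment M φ s c o)
        (bindAssignment M (clockAssignment M φ s c o) γ) := by
  have : clockAssignment M φ s (Function.update c o γ) o = clockAssignment M φ s c o := by
    refine clockAssignment_congr fun o' _ hl => ?_
    have h1 : o' ≠ o := by rintro rfl; simp at hl
    simp [h1]
  rw [clockAssignment_concat, this]
  simp

variable (M φ s) in
/-- Truth of a position: the current formula holds at the current world under the assignment
given by the clock. -/
def PosTrue (p : GPos W) : Prop :=
  ∀ χ ∈ nodeAt φ p.addr, p.world ∈ sat M χ (clockAssignment M φ s p.clock p.addr)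

theorem posTrue_iff {v : W} {o : List ℕ} {c : List ℕ → Ordinal} {χ : Formula Φ Λ}
    (h : nodeAt φ o = some χ) :
    PosTrue M φ s ⟨v, o, c⟩ ↔ v ∈ sat M χ (clockAssignment M φ s c o) := by
  simp [PosTrue, h]

/-- The local correctness condition relating truth to the rules of the game. -/
theorem posTrue_local [Fintype W] (hsen : IsSentence φ) (p : GPos W) :
    (turn φ p = some .eloise ∧ winsTerminal M φ p = .abelard ∧
      (PosTrue M φ s p ↔ ∃ q ∈ moves M φ ((Fintype.card W : Ordinal) + 1) p,
        PosTrue M φ s q)) ∨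
    (turn φ p = some .abelard ∧ winsTerminal M φ p = .eloise ∧
      (PosTrue M φ s p ↔ ∀ q ∈ moves M φ ((Fintype.card W : Ordinal) + 1) p,
        PosTrue M φ s q)) ∨
    (turn φ p = none ∧ moves M φ ((Fintype.card W : Ordinal) + 1) p = ∅ ∧
      (PosTrue M φ s p ↔ winsTerminal M φ p = .eloise)) := by
  obtain ⟨v, o, c⟩ := p
  rcases hχ : nodeAt φ o with _ | χ
  · simp [turn, moves, winsTerminal, hχ, PosTrue]
  have hchild (i : ℕ) : nodeAt φ (o ++ [i]) = nodeAt χ [i] := by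
    rw [nodeAt_append, hχ]; rfl
  have h0 := hchild 0
  have h1 := hchild 1
  have hstep (i : ℕ) := clockAssignment_concat (M := M) (φ := φ) (s := s) c o i
  simp only [hχ, Option.elim_some] at hstep
  cases χ with
  | atom q =>
    refine .inr (.inr ⟨by simp [turn, hχ], by simp [moves, hχ], ?_⟩)
    rw [posTrue_iff hχ]
    simp [winsTerminal, hχ, sat]
  | natom q =>
    refine .inr (.inr ⟨by simp [turn, hχ], by simp [moves, hχ], ?_⟩)
    rw [posTrue_iff hχ]
    simp [winsTerminal, hχ, sat]
  | label X =>
    rcases hr : refOcc φ X o with _ | r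
    · have := mem_freeLabels_of_refOcc_eq_none hχ (Set.mem_singleton X) hr
      rw [hsen] at this
      exact this.elim
    have hval := clockAssignment_of_refOcc (M := M) (s := s) c 0 hr
    rw [hstep, clockAssignment_concat] at hval
    obtain ⟨ψ, hψ⟩ := bindsAt_eq_true_iff.1 (refOcc_eq_some hr).2
    rcases hψ with hψ | hψ
    all_goals
      have hbody : nodeAt φ (r ++ [0]) = some ψ := by
        rw [nodeAt_append, hψ]; simp [nodeAt, nodeAt_nil]
      have hreset (γ : Ordinal) := clockAssignment_clockReset (M := M) (φ := φ) (s := s)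
        ((Fintype.card W : Ordinal) + 1) γ c r
      simp only [hψ, Option.elim_some, bindAssignment, Function.update_self] at hval hreset
    · refine .inl ⟨by simp [turn, hχ, hr, hψ], by simp [turn, winsTerminal, hχ, hr, hψ], ?_⟩
      rw [posTrue_iff hχ, sat, hval, mem_approxMu]
      simp [moves, hχ, hr, posTrue_iff hbody, hreset]
    · refine .inr (.inl ⟨by simp [turn, hχ, hr, hψ], by simp [turn, winsTerminal, hχ, hr, hψ], ?_⟩)
      rw [posTrue_iff hχ, sat, hval, mem_approxNu]
      simp only [moves, hχ, hr, Set.mem_ofPred_eq]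
      constructor
      · rintro h _ ⟨γ, hγ, rfl⟩
        rw [posTrue_iff hbody, hreset]
        exact h γ hγ
      · intro h γ hγ
        have := h _ ⟨γ, hγ, rfl⟩
        rwa [posTrue_iff hbody, hreset] at this
  | or χ₀ χ₁ =>
    simp only [nodeAt, nodeAt_nil] at h0 h1
    refine .inl ⟨by simp [turn, hχ], by simp [turn, winsTerminal, hχ], ?_⟩
    simp [moves, hχ, posTrue_iff hχ, posTrue_iff h0, posTrue_iff h1, hstep, bindAssignment, sat]
  | and χ₀ χ₁ =>
    simp only [nodeAt, nodeAt_nil] at h0 h1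
    refine .inr (.inl ⟨by simp [turn, hχ], by simp [turn, winsTerminal, hχ], ?_⟩)
    simp [moves, hχ, posTrue_iff hχ, posTrue_iff h0, posTrue_iff h1, hstep, bindAssignment, sat]
  | dia ψ =>
    simp only [nodeAt, nodeAt_nil] at h0
    refine .inl ⟨by simp [turn, hχ], by simp [turn, winsTerminal, hχ], ?_⟩
    rw [posTrue_iff hχ, sat]
    simp [moves, hχ, posTrue_iff h0, hstep, bindAssignment]
  | box ψ =>
    simp only [nodeAt, nodeAt_nil] at h0
    refine .inr (.inl ⟨by simp [turn, hχ], by simp [turn, winsTerminal, hχ], ?_⟩)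
    rw [posTrue_iff hχ, sat]
    simp only [moves, hχ, Set.mem_ofPred_eq]
    constructor
    · rintro h _ ⟨v', hv', rfl⟩
      rw [posTrue_iff h0, hstep]
      exact h v' hv'
    · intro h v' hv'
      have := h _ ⟨v', hv', rfl⟩
      rwa [posTrue_iff h0, hstep] at this
  | mu X ψ =>
    simp only [nodeAt, nodeAt_nil] at h0
    have hupd (γ : Ordinal) := clockAssignment_update (M := M) (φ := φ) (s := s) γ c o
    simp only [hχ, Option.elim_some, bindAssignment] at hupd
    refine .inl ⟨by simp [turn, hχ], by simp [turn, winsTerminal, hχ], ?_⟩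
    rw [posTrue_iff hχ, sat, mem_sInf_prefixed_iff (sat_update_mono M ψ _ X)]
    simp only [moves, hχ, Set.mem_ofPred_eq]
    constructor
    · rintro ⟨γ, hγ, h⟩
      exact ⟨_, ⟨γ, hγ, rfl⟩, by rwa [posTrue_iff h0, hupd]⟩
    · rintro ⟨_, ⟨γ, hγ, rfl⟩, h⟩
      rw [posTrue_iff h0, hupd] at h
      exact ⟨γ, hγ, h⟩
  | nu X ψ =>
    simp only [nodeAt, nodeAt_nil] at h0
    have hupd (γ : Ordinal) := clockAssignment_update (M := M) (φ := φ) (s := s) γ c o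
    simp only [hχ, Option.elim_some, bindAssignment] at hupd
    refine .inr (.inl ⟨by simp [turn, hχ], by simp [turn, winsTerminal, hχ], ?_⟩)
    rw [posTrue_iff hχ, sat, mem_sSup_postfixed_iff (sat_update_mono M ψ _ X)]
    simp only [moves, hχ, Set.mem_ofPred_eq]
    constructor
    · rintro h _ ⟨γ, hγ, rfl⟩
      rw [posTrue_iff h0, hupd]
      exact h γ hγ
    · intro h γ hγ
      have := h _ ⟨γ, hγ, rfl⟩
      rwa [posTrue_iff h0, hupd] at this

end Truth

section Termination

variable [DecidableEq Λ]

/-- The clock values along the branch to the current address, padded by `⊤`. -/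
noncomputable def branchClock (D : ℕ) (p : GPos W) (i : Fin D) : WithTop Ordinal :=
  if (i : ℕ) < p.addr.length then ((p.clock (p.addr.take i) : Ordinal) : WithTop Ordinal) else ⊤

theorem branchClock_lt_of_child {D : ℕ} {v v' : W} {o : List ℕ} {c c' : List ℕ → Ordinal}
    (i : ℕ) (hD : o.length < D) (hc : ∀ o', o' ≠ o → c' o' = c o') :
    Pi.Lex (· < ·) (fun {_} => (· < ·)) (branchClock D (⟨v', o ++ [i], c'⟩ : GPos W))
      (branchClock D ⟨v, o, c⟩) := by
  refine ⟨⟨o.length, hD⟩, fun j hj => ?_, ?_⟩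
  · have hj' : (j : ℕ) < o.length := hj
    have hne : o.take j ≠ o := fun h => by
      have := congrArg List.length h
      simp at this
      omega
    simp [branchClock, hj', hj'.trans (Nat.lt_succ_self _), List.take_append_of_le_length hj'.le,
      hc _ hne]
  · simp [branchClock]

theorem branchClock_lt_of_jump {D : ℕ} {v v' : W} {o r : List ℕ} {c : List ℕ → Ordinal}
    {Γ γ : Ordinal} (hD : o.length < D) (hro : r <+: o) (hne : r ≠ o) (hγ : γ < c r) :
    Pi.Lex (· < ·) (fun {_} => (· < ·))
      (branchClock D (⟨v', r ++ [0], clockReset Γ γ r c⟩ : GPos W))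
      (branchClock D ⟨v, o, c⟩) := by
  have hlt : r.length < o.length :=
    lt_of_le_of_ne hro.length_le fun h => hne (hro.eq_of_length h)
  obtain ⟨t, rfl⟩ := hro
  refine ⟨⟨r.length, hlt.trans hD⟩, fun j hj => ?_, ?_⟩
  · have hj' : (j : ℕ) < r.length := hj
    have hne' : r.take j ≠ r := fun h => by
      have := congrArg List.length h
      simp at this
      omega
    have hpre : ¬ (r ++ [0] <+: r.take j) := fun h => by
      have := h.length_le
      simp at this
    simp [branchClock, hj'.trans (Nat.lt_succ_self _),
      List.take_append_of_le_length hj'.le, clockReset, hne', hpre]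
    omega
  · have : 0 < t.length := by simpa using hlt
    simp [branchClock, this, clockReset, hγ]

theorem branchClock_lt_of_mem_moves {M : Kripke Φ W} {φ : Formula Φ Λ} {Γ : Ordinal} {D : ℕ}
    (hD : ∀ o χ, nodeAt φ o = some χ → o.length < D) {p q : GPos W}
    (h : q ∈ moves M φ Γ p) :
    Pi.Lex (· < ·) (fun {_} => (· < ·)) (branchClock D q) (branchClock D p) := by
  obtain ⟨v, o, c⟩ := p
  rcases hχ : nodeAt φ o with _ | χ
  · simp [moves, hχ] at h
  have hlen := hD o χ hχ
  cases χ with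
  | atom | natom => simp [moves, hχ] at h
  | or | and =>
    simp only [moves, hχ, Set.mem_insert_iff, Set.mem_singleton_iff] at h
    rcases h with rfl | rfl <;> exact branchClock_lt_of_child _ hlen fun _ _ => rfl
  | dia | box =>
    simp only [moves, hχ] at h
    obtain ⟨v', -, rfl⟩ := h
    exact branchClock_lt_of_child _ hlen fun _ _ => rfl
  | mu | nu =>
    simp only [moves, hχ] at h
    obtain ⟨γ, -, rfl⟩ := h
    exact branchClock_lt_of_child _ hlen fun _ hne => Function.update_of_ne hne _ _
  | label X =>
    rcases hr : refOcc φ X o with _ | r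
    · simp [moves, hχ, hr] at h
    · simp only [moves, hχ, hr] at h
      obtain ⟨γ, hγ, rfl⟩ := h
      obtain ⟨hro, hb⟩ := refOcc_eq_some hr
      refine branchClock_lt_of_jump hlen hro ?_ hγ
      rintro rfl
      simp [bindsAt, hχ] at hb

/-- Every play of a bounded evaluation game is finite. -/
theorem moves_wellFounded (M : Kripke Φ W) (φ : Formula Φ Λ) (Γ : Ordinal) :
    WellFounded fun q p : GPos W => q ∈ moves M φ Γ p := by
  obtain ⟨D, hD⟩ := exists_length_lt_of_nodeAt φ
  have hwf : WellFounded (Pi.Lex (ι := Fin D) (β := fun _ => WithTop Ordinal) (· < ·)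
      (fun {_} => (· < ·))) := Pi.Lex.wellFounded _ fun _ => wellFounded_lt
  exact Subrelation.wf (fun h => branchClock_lt_of_mem_moves hD h)
    (InvImage.wf (branchClock D) hwf)

end Termination

section Plays

variable [DecidableEq Λ] {M : Kripke Φ W} {φ : Formula Φ Λ} {Γ : Ordinal} {w : W} {P : Player}
  {σ : GPos W → GPos W}

theorem consPlay_singleton : ConsPlay M φ Γ w P σ [initPos w Γ] :=
  ⟨rfl, fun i h => by simp at h⟩

theorem ConsPlay.concat {f : List (GPos W)} {p q : GPos W} (hf : ConsPlay M φ Γ w P σ f)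
    (hp : f.getLast? = some p) (hq : q ∈ moves M φ Γ p)
    (hσ : turn φ p = some P → q = σ p) : ConsPlay M φ Γ w P σ (f ++ [q]) := by
  have hne : f ≠ [] := by rintro rfl; simp at hp
  refine ⟨by rw [List.head?_append_of_ne_nil _ hne]; exact hf.1, fun i h => ?_⟩
  rcases Nat.lt_or_ge (i + 1) f.length with hi | hi
  · simpa [List.getElem_append_left hi, List.getElem_append_left (Nat.lt_of_succ_lt hi)]
      using hf.2 i hi
  · have hi' : i + 1 = f.length := by
      simp at h
      omega
    have hpi : f[i]'(by omega) = p := by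
      rw [List.getLast?_eq_getElem?, ← hi'] at hp
      simpa [List.getElem?_eq_some_iff, show i < f.length by omega] using hp
    have hlt : i < f.length := by omega
    simp [List.getElem_append_left hlt, List.getElem_append_right hi, hpi, hq]
    exact hσ

/-- A property that holds initially and is preserved by the moves of a play holds at its end. -/
theorem ConsPlay.induction {T : GPos W → Prop} {f : List (GPos W)}
    (hf : ConsPlay M φ Γ w P σ f) (h0 : T (initPos w Γ))
    (hstep : ∀ p q, T p → q ∈ moves M φ Γ p → (turn φ p = some P → q = σ p) → T q)
    {p : GPos W} (hp : f.getLast? = some p) : T p := by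
  have hall : ∀ i, (hi : i < f.length) → T f[i] := by
    intro i
    induction i with
    | zero =>
      intro hi
      have := hf.1
      rw [List.head?_eq_getElem?, List.getElem?_eq_getElem hi] at this
      rw [Option.some.inj this]
      exact h0
    | succ i ih =>
      intro hi
      exact hstep _ _ (ih (by omega)) (hf.2 i hi).1 (hf.2 i hi).2
  obtain ⟨i, hi, rfl⟩ := List.getElem_of_mem (List.mem_of_getLast? hp)
  exact hall i hi

end Plays

section Soundness

variable [DecidableEq Λ] [Fintype W] {M : Kripke Φ W} {φ : Formula Φ Λ} {s : Λ → Set W} {w : W}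

theorem exists_winStrat_of_posTrue (hsen : IsSentence φ)
    (h : PosTrue M φ s (initPos w ((Fintype.card W : Ordinal) + 1))) :
    ∃ σ, WinStrat M φ ((Fintype.card W : Ordinal) + 1) w .eloise σ := by
  have hex (p : GPos W) : ∃ q, (∃ q ∈ moves M φ ((Fintype.card W : Ordinal) + 1) p,
      PosTrue M φ s q) →
      q ∈ moves M φ ((Fintype.card W : Ordinal) + 1) p ∧ PosTrue M φ s q := by
    by_cases hp : ∃ q ∈ moves M φ ((Fintype.card W : Ordinal) + 1) p, PosTrue M φ s q
    · exact ⟨hp.choose, fun _ => hp.choose_spec⟩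
    · exact ⟨p, fun h => absurd h hp⟩
  choose σ hσ using hex
  refine ⟨σ, fun f hf p hp => ?_⟩
  have hT : PosTrue M φ s p := by
    refine hf.induction h (fun p q hpT hq hturn => ?_) hp
    rcases posTrue_local (M := M) (s := s) hsen p with ⟨ht, -, hiff⟩ | ⟨-, -, hiff⟩ | ⟨-, he, -⟩
    · rw [hturn ht]
      exact (hσ p (hiff.1 hpT)).2
    · exact hiff.1 hpT q hq
    · simp [he] at hq
  rcases posTrue_local (M := M) (s := s) hsen p with
    ⟨-, -, hiff⟩ | ⟨ht, hw, -⟩ | ⟨ht, -, hiff⟩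
  · refine ⟨fun _ _ => (hσ p (hiff.1 hT)).1, fun he => ?_⟩
    obtain ⟨q, hq, -⟩ := hiff.1 hT
    simp [he] at hq
  · exact ⟨fun h' => by simp [ht] at h', fun _ => hw⟩
  · exact ⟨fun h' => by simp [ht] at h', fun _ => hiff.1 hT⟩

theorem WinStrat.posTrue (hsen : IsSentence φ) {σ : GPos W → GPos W}
    (hσ : WinStrat M φ ((Fintype.card W : Ordinal) + 1) w .eloise σ) :
    PosTrue M φ s (initPos w ((Fintype.card W : Ordinal) + 1)) := by
  have key (p : GPos W) : ∀ f, ConsPlay M φ ((Fintype.card W : Ordinal) + 1) w .eloise σ f →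
      f.getLast? = some p → PosTrue M φ s p := by
    induction p using (moves_wellFounded M φ ((Fintype.card W : Ordinal) + 1)).induction with
    | _ p ih =>
    intro f hf hp
    have hwin := hσ f hf p hp
    rcases posTrue_local (M := M) (s := s) hsen p with
      ⟨ht, hw, hiff⟩ | ⟨ht, -, hiff⟩ | ⟨-, he, hiff⟩
    · have hne : (moves M φ ((Fintype.card W : Ordinal) + 1) p).Nonempty := by
        rw [Set.nonempty_iff_ne_empty]
        intro he
        have := hwin.2 he
        simp [hw] at this
      have hmem := hwin.1 ht hne
      exact hiff.2 ⟨σ p, hmem, ih _ hmem _ (hf.concat hp hmem fun _ => rfl) (by simp)⟩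
    · refine hiff.2 fun q hq => ih q hq _ (hf.concat hp hq fun h' => ?_) (by simp)
      simp [ht] at h'
    · exact hiff.2 (hwin.2 he)
  exact key _ _ consPlay_singleton rfl

end Soundness

/-- For a Kripke model `M` with `W` finite of cardinality `n`, a world `w`
and a sentence `φ` of the modal μ-calculus in normal form: `M,w ⊨ φ` in the standard
compositional semantics (truth of a sentence being independent of the assignment) iff
Eloise has a winning strategy in the `(n+1)`-bounded evaluation game `(M, w, φ, n+1)`;
in particular, on finite models finite clock values at most the cardinality of the model
suffice. -/
theorem gts_equiv_standard_finite [DecidableEq Λ] [Fintype W] [Nonempty W]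
    (M : Kripke Φ W) (w : W) (n : ℕ) (hn : Fintype.card W = n)
    (φ : Formula Φ Λ) (hsen : IsSentence φ) (hnf : NormalForm φ) :
    (∀ s, w ∈ sat M φ s) ↔
      ∃ σ, WinStrat M φ ((n : Ordinal) + 1) w Player.eloise σ := by
  subst hn
  constructor
  · intro h
    exact exists_winStrat_of_posTrue (s := fun _ => ∅) hsen
      ((posTrue_iff (nodeAt_nil φ)).2 (h _))
  · rintro ⟨σ, hσ⟩ s
    exact (posTrue_iff (nodeAt_nil φ)).1 (hσ.posTrue (s := s) hsen)
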